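/- Grant the compatibility condition ζ ≤ √(2⌊K/2⌋)/(4K). There exist constants c=c(K)>0 and ε₀>0 such that whenever ε≤ε₀, δ≤1/6, L≤1/3 and n·δ²·ε⁴·ζ⁶ ≥ 1: the infimum over all estimators φ̂₁ (measurable functions of (Y₁,…,Yₙ)) of sup over (φ,ψ)∈Φ_L(δ,ε,ζ) of P_{(φ,ψ)}( min(|φ̂₁−φ₁|², |φ̂₁+φ₁|²) ≥ c/(n·ε⁴·ζ⁶) ) is at least 1/4; and likewise the infimum over estimators of sup over Φ_L of P_{(φ,ψ)}( |(1−φ̂₁²)/(1−φ₁²) − 1|² ≥ 2c/(n·δ²·ε⁴·ζ⁶) ) is at least 1/4. -/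

import Mathlib

open scoped BigOperators

namespace PaperHMM

/-- Parameter of a two-state HMM with multinomial emissions on `Fin K`. -/
structure Param (K : ℕ) where
  p : ℝ
  q : ℝ
  f0 : Fin K → ℝ
  f1 : Fin K → ℝ

/-- `f` is a probability density with respect to counting measure on `Fin K`. -/
def IsDensity {K : ℕ} (f : Fin K → ℝ) : Prop :=
  (∀ k, 0 ≤ f k) ∧ ∑ k, f k = 1

/-- Validity of HMM parameters: `p, q ∈ (0,1)` and emission densities. -/
def Valid {K : ℕ} (θ : Param K) : Prop :=
  θ.p ∈ Set.Ioo (0 : ℝ) 1 ∧ θ.q ∈ Set.Ioo (0 : ℝ) 1 ∧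
    IsDensity θ.f0 ∧ IsDensity θ.f1

/-- Euclidean norm of a finitely supported real function. -/
noncomputable def enormF {α : Type*} [Fintype α] (g : α → ℝ) : ℝ :=
  Real.sqrt (∑ a, (g a) ^ 2)

/-- Stationary initial distribution of the hidden chain: `P(X₁=0)=q/(p+q)`. -/
noncomputable def initD {K : ℕ} (θ : Param K) : Fin 2 → ℝ :=
  fun a => if a = 0 then θ.q / (θ.p + θ.q) else θ.p / (θ.p + θ.q)

/-- Transition matrix `Q = [[1-p, p], [q, 1-q]]` of the hidden chain. -/
noncomputable def transP {K : ℕ} (θ : Param K) : Fin 2 → Fin 2 → ℝ :=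
  fun a b =>
    if a = 0 then (if b = 0 then 1 - θ.p else θ.p)
    else (if b = 0 then θ.q else 1 - θ.q)

/-- Emission densities indexed by the hidden state. -/
def emit {K : ℕ} (θ : Param K) : Fin 2 → Fin K → ℝ :=
  fun a => if a = 0 then θ.f0 else θ.f1

/-- The probability mass function `p_θ^{(n)}` of the first `n` observations
`(Y₁,…,Yₙ)`:  `∑_{x ∈ {0,1}ⁿ} P(X₁=x₁) ∏_{i<n} Q_{x_i,x_{i+1}} ∏_{i≤n} f_{x_i}(y_i)`. -/
noncomputable def pLaw {K : ℕ} (θ : Param K) (n : ℕ) (y : Fin n → Fin K) : ℝ :=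
  ∑ x : Fin n → Fin 2,
    (∏ i : Fin n,
        (if (i : ℕ) = 0 then initD θ (x i)
          else transP θ (x ⟨(i : ℕ) - 1, lt_of_le_of_lt (Nat.sub_le _ _) i.isLt⟩) (x i)))
      * ∏ i : Fin n, emit θ (x i) (y i)

open Classical in
/-- Probability under `P_θ` that `(Y₁,…,Yₙ)` lies in the event `E`. -/
noncomputable def probOf {K : ℕ} (θ : Param K) (n : ℕ)
    (E : (Fin n → Fin K) → Prop) : ℝ :=
  ∑ y : Fin n → Fin K, if E y then pLaw θ n y else 0

/-- The parameter class `Θ(δ,ε,ζ)`. -/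
def ThetaSet (K : ℕ) (δ ε ζ : ℝ) : Set (Param K) :=
  {θ | Valid θ ∧ δ ≤ θ.p ∧ δ ≤ θ.q ∧ ε ≤ |1 - θ.p - θ.q| ∧
    ζ ≤ enormF (fun k => θ.f0 k - θ.f1 k)}

/-- The parameter class `Θ_L(δ,ε,ζ)`. -/
def ThetaL (K : ℕ) (L δ ε ζ : ℝ) : Set (Param K) :=
  ThetaSet K δ ε ζ ∩ {θ | L ≤ 1 - |1 - θ.p - θ.q|}

/-- The reparametrised pair `(φ, ψ)`: scalar parameters `φ = (φ₁,φ₂,φ₃)` and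
vector parameters `ψ = (ψ₁, ψ₂)`. -/
abbrev PP (K : ℕ) := (ℝ × ℝ × ℝ) × ((Fin K → ℝ) × (Fin K → ℝ))

/-- `φ(θ) = ((q-p)/(p+q), 1-p-q, ‖f₀-f₁‖)`. -/
noncomputable def phiOf {K : ℕ} (θ : Param K) : ℝ × ℝ × ℝ :=
  ((θ.q - θ.p) / (θ.p + θ.q), 1 - θ.p - θ.q,
    enormF (fun k => θ.f0 k - θ.f1 k))

/-- `ψ(θ) = ((q f₀ + p f₁)/(p+q), (f₀-f₁)/‖f₀-f₁‖)`. -/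
noncomputable def psiOf {K : ℕ} (θ : Param K) : (Fin K → ℝ) × (Fin K → ℝ) :=
  (fun k => (θ.q * θ.f0 k + θ.p * θ.f1 k) / (θ.p + θ.q),
    fun k => (θ.f0 k - θ.f1 k) / enormF (fun j => θ.f0 j - θ.f1 j))

/-- The map `θ ↦ (φ(θ), ψ(θ))`. -/
noncomputable def pack {K : ℕ} (θ : Param K) : PP K := (phiOf θ, psiOf θ)

/-- The inverse parametrisation `θ(φ,ψ)`:
`p = ½(1-φ₂)(1-φ₁)`, `q = ½(1-φ₂)(1+φ₁)`,
`f₀ = ψ₁ - ½φ₁φ₃ψ₂ + ½φ₃ψ₂`, `f₁ = ψ₁ - ½φ₁φ₃ψ₂ - ½φ₃ψ₂`. -/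
noncomputable def unpack {K : ℕ} (π : PP K) : Param K where
  p := (1 - π.1.2.1) * (1 - π.1.1) / 2
  q := (1 - π.1.2.1) * (1 + π.1.1) / 2
  f0 := fun k => π.2.1 k - π.1.1 * π.1.2.2 * π.2.2 k / 2 + π.1.2.2 * π.2.2 k / 2
  f1 := fun k => π.2.1 k - π.1.1 * π.1.2.2 * π.2.2 k / 2 - π.1.2.2 * π.2.2 k / 2

/-- `Φ(δ,ε,ζ)`. -/
def PhiSet (K : ℕ) (δ ε ζ : ℝ) : Set (PP K) := pack '' ThetaSet K δ ε ζ

/-- `Φ_L(δ,ε,ζ)`. -/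
def PhiL (K : ℕ) (L δ ε ζ : ℝ) : Set (PP K) := pack '' ThetaL K L δ ε ζ

/-- `⋃_{δ,ε,ζ} Φ(δ,ε,ζ)`. -/
def PhiAll (K : ℕ) : Set (PP K) :=
  ⋃ (δ ∈ Set.Ioo (0 : ℝ) 1) (ε ∈ Set.Ioo (0 : ℝ) 1) (ζ ∈ Set.Ioi (0 : ℝ)),
    PhiSet K δ ε ζ

/-- `r(φ) = ¼ (1-φ₁²) φ₂ φ₃²`. -/
noncomputable def rfun (φ : ℝ × ℝ × ℝ) : ℝ :=
  (1 - φ.1 ^ 2) * φ.2.1 * φ.2.2 ^ 2 / 4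

/-- `m(φ) = (r(φ), φ₂ r(φ), φ₁ φ₂ φ₃ r(φ))`. -/
noncomputable def mvec (φ : ℝ × ℝ × ℝ) : ℝ × ℝ × ℝ :=
  (rfun φ, φ.2.1 * rfun φ, φ.1 * φ.2.1 * φ.2.2 * rfun φ)

/-- Sign function with the convention `sgn 0 = +1`. -/
noncomputable def sgn (t : ℝ) : ℝ := if t < 0 then -1 else 1

/-- The statistical distance `ρ((φ,ψ);(φ̃,ψ̃))`. -/
noncomputable def rho {K : ℕ} (π π' : PP K) : ℝ :=
  max (max (max (max
    |(mvec π.1).1 - (mvec π'.1).1|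
    |(mvec π.1).2.1 - (mvec π'.1).2.1|)
    |(mvec π.1).2.2 - sgn (∑ k, π.2.2 k * π'.2.2 k) * (mvec π'.1).2.2|)
    (enormF fun k => π.2.1 k - π'.2.1 k))
    ((max |(mvec π.1).1| |(mvec π'.1).1|) *
      enormF fun k => π.2.2 k - sgn (∑ j, π.2.2 j * π'.2.2 j) * π'.2.2 k)

/-- `p^{(3)}_{φ,ψ} = p^{(3)}_{θ(φ,ψ)}`, the law of three consecutive observations. -/
noncomputable def p3 {K : ℕ} (π : PP K) : (Fin 3 → Fin K) → ℝ :=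
  pLaw (unpack π) 3

/-- The empirical estimator `p̂ₙ^{(3)}(a,b,c) = n⁻¹ ∑_{i=1}^{n-2} 1{Yᵢ=a, Y_{i+1}=b, Y_{i+2}=c}`. -/
noncomputable def empP3 {K : ℕ} (n : ℕ) (y : Fin n → Fin K)
    (v : Fin 3 → Fin K) : ℝ :=
  (n : ℝ)⁻¹ * ∑ i : Fin n,
    if h : (i : ℕ) + 2 < n then
      (if y i = v 0 ∧ y ⟨(i : ℕ) + 1, by omega⟩ = v 1 ∧ y ⟨(i : ℕ) + 2, h⟩ = v 2
        then 1 else 0)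
    else 0

/-- Kullback–Leibler divergence `K(P;Q) = ∑_y P(y) log(P(y)/Q(y))` between
probability mass functions on `(Fin K)ⁿ`. -/
noncomputable def klDiv {K : ℕ} (n : ℕ) (P Q : (Fin n → Fin K) → ℝ) : ℝ :=
  ∑ y : Fin n → Fin K, P y * Real.log (P y / Q y)



/-! ### Helper material -/

/-- Law of the observations with general initial distribution of the hidden chain. -/
noncomputable def gLaw {K : ℕ} (θ : Param K) (ν : Fin 2 → ℝ) (n : ℕ) (y : Fin n → Fin K) : ℝ :=
  ∑ x : Fin n → Fin 2,
    (∏ i : Fin n,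
        (if (i : ℕ) = 0 then ν (x i)
          else transP θ (x ⟨(i : ℕ) - 1, lt_of_le_of_lt (Nat.sub_le _ _) i.isLt⟩) (x i)))
      * ∏ i : Fin n, emit θ (x i) (y i)

lemma gLaw_zero {K : ℕ} (θ : Param K) (ν : Fin 2 → ℝ) (y : Fin 0 → Fin K) :
    gLaw θ ν 0 y = 1 := by
  simp [gLaw]

lemma gLaw_succ {K : ℕ} (θ : Param K) (ν : Fin 2 → ℝ) (n : ℕ) (y : Fin (n + 1) → Fin K) :
    gLaw θ ν (n + 1) y
      = ∑ a, ν a * emit θ a (y 0) * gLaw θ (transP θ a) n (fun i => y i.succ) := by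
  unfold gLaw
  rw [← (Fin.consEquiv (fun _ => Fin 2)).sum_comp, Fintype.sum_prod_type]
  refine Finset.sum_congr rfl fun a _ => ?_
  rw [Finset.mul_sum]
  refine Finset.sum_congr rfl fun x _ => ?_
  rw [Fin.prod_univ_succ, Fin.prod_univ_succ (f := fun i => emit θ _ (y i))]
  have h : ∀ i : Fin n,
      (if ((i.succ : Fin (n + 1)) : ℕ) = 0 then ν ((Fin.consEquiv (fun _ => Fin 2)) (a, x) i.succ)
        else transP θ ((Fin.consEquiv (fun _ => Fin 2)) (a, x)
            ⟨((i.succ : Fin (n + 1)) : ℕ) - 1, lt_of_le_of_lt (Nat.sub_le _ _) i.succ.isLt⟩)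
          ((Fin.consEquiv (fun _ => Fin 2)) (a, x) i.succ))
      = (if (i : ℕ) = 0 then transP θ a (x i)
          else transP θ (x ⟨(i : ℕ) - 1, lt_of_le_of_lt (Nat.sub_le _ _) i.isLt⟩) (x i)) := by
    intro i
    rcases i with ⟨i, hi⟩
    rcases i with _ | j
    · rw [if_neg (by simp), if_pos rfl]
      rfl
    · rw [if_neg (by simp), if_neg (by simp)]
      rfl
  rw [Finset.prod_congr rfl fun i _ => h i]
  simp only [Fin.consEquiv, Equiv.coe_fn_mk, Fin.cons_zero, Fin.cons_succ, Fin.val_zero, if_true]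
  ring

lemma gLaw_lin {K : ℕ} (θ : Param K) (w ν : Fin 2 → ℝ) (Z : ℝ) (h1 : ∑ a, w a = Z)
    (h2 : ∀ c, ∑ a, w a * transP θ a c = Z * ν c) (n : ℕ) (y : Fin n → Fin K) :
    ∑ a, w a * gLaw θ (transP θ a) n y = Z * gLaw θ ν n y := by
  cases n with
  | zero => simp only [gLaw_zero, mul_one, h1]
  | succ n =>
    simp only [gLaw_succ]
    simp only [Finset.mul_sum]
    rw [Finset.sum_comm]
    refine Finset.sum_congr rfl fun c _ => ?_
    have := h2 c
    calc ∑ a, w a * (transP θ a c * emit θ c (y 0) * gLaw θ (transP θ c) n fun i => y i.succ)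
        = (∑ a, w a * transP θ a c) * (emit θ c (y 0) * gLaw θ (transP θ c) n fun i => y i.succ) := by
          rw [Finset.sum_mul]; exact Finset.sum_congr rfl fun a _ => by ring
      _ = _ := by rw [this]; ring

/-- One-step update of the (rescaled) filter. -/
noncomputable def filt (ε R κ M s : ℝ) : ℝ := ε * (M + s * (R - κ * M)) / (1 + M * s)

/-- Product form of the likelihood. -/
noncomputable def hLaw {K : ℕ} (sv : Fin K → ℝ) (ε R κ : ℝ) :
    (n : ℕ) → ℝ → (Fin n → Fin K) → ℝ
  | 0, _, _ => 1
  | n + 1, M, y => (1 / (K : ℝ)) * (1 + M * sv (y 0)) *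
      hLaw sv ε R κ n (filt ε R κ M (sv (y 0))) (fun i => y i.succ)

/-- The parameters used in the lower bound. -/
noncomputable def mk {K : ℕ} (sv : Fin K → ℝ) (ε a b : ℝ) : Param K where
  p := (1 - ε) * (1 - a) / 2
  q := (1 - ε) * (1 + a) / 2
  f0 := fun k => (1 / (K : ℝ)) * (1 + (1 - a) / 2 * b * sv k)
  f1 := fun k => (1 / (K : ℝ)) * (1 - (1 + a) / 2 * b * sv k)

lemma abs_filt_le {ε R κ M s : ℝ} (hε : 0 < ε) (hε' : ε ≤ 1 / 10) (hR : 0 < R) (hR' : R ≤ 1 / 10)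
    (hκ : |κ| ≤ 1 / 3) (hM : |M| ≤ 2 * ε * R) (hs : |s| ≤ 1) :
    |filt ε R κ M s| ≤ 2 * ε * R := by
  have hεR : ε * R ≤ 1 / 100 := by nlinarith
  have hMs : |M * s| ≤ 1 / 50 := by
    rw [abs_mul]; nlinarith [abs_nonneg M, abs_nonneg s]
  have hd : 49 / 50 ≤ 1 + M * s := by linarith [(abs_le.mp hMs).1]
  unfold filt
  rw [abs_div, abs_of_pos (show 0 < 1 + M * s by linarith), div_le_iff₀ (by linarith), abs_mul,
    abs_of_pos hε]
  have h1 : |M + s * (R - κ * M)| ≤ |M| + (R + 1 / 3 * |M|) := by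
    have h2 : |R - κ * M| ≤ R + 1 / 3 * |M| := by
      calc |R - κ * M| ≤ |R| + |κ * M| := abs_sub _ _
        _ ≤ _ := by rw [abs_mul, abs_of_pos hR]; nlinarith [abs_nonneg M]
    calc _ ≤ |M| + |s * (R - κ * M)| := abs_add_le _ _
      _ ≤ _ := by rw [abs_mul]; nlinarith [abs_nonneg (R - κ * M)]
  have h3 : |M + s * (R - κ * M)| ≤ 13 / 10 * R := by nlinarith
  have h4 : 0 < ε * R := by positivity
  nlinarith

lemma filt_sub_le {ε R κ κ' M M' s D Δ : ℝ} (hε : 0 < ε) (hε' : ε ≤ 1 / 10) (hR : 0 < R)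
    (hR' : R ≤ 1 / 10) (hκ : |κ| ≤ 1 / 3) (hM : |M| ≤ 2 * ε * R) (hM' : |M'| ≤ 2 * ε * R)
    (hs : |s| ≤ 1) (hΔ : |κ - κ'| ≤ Δ) (hD : D = 4 * ε ^ 2 * R * Δ) (hMM : |M - M'| ≤ D) :
    |filt ε R κ M s - filt ε R κ' M' s| ≤ D := by
  have hεR : ε * R ≤ 1 / 100 := by nlinarith
  have hb : ∀ x : ℝ, |x| ≤ 2 * ε * R → 49 / 50 ≤ 1 + x * s := by
    intro x hx
    have hMs : |x * s| ≤ 1 / 50 := by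
      rw [abs_mul]; nlinarith [abs_nonneg x, abs_nonneg s]
    linarith [(abs_le.mp hMs).1]
  have hd := hb M hM
  have hd' := hb M' hM'
  have hΔ0 : 0 ≤ Δ := (abs_nonneg _).trans hΔ
  have hD0 : 0 ≤ D := (abs_nonneg _).trans hMM
  have hss : |s| * |s| ≤ 1 := by nlinarith [abs_nonneg s]
  have hs2 : s ^ 2 ≤ 1 := by rw [← sq_abs]; nlinarith
  have key : filt ε R κ M s - filt ε R κ' M' s
      = ε * ((M - M') * (1 - s ^ 2 * R) - s * (κ * (M - M') + (κ - κ') * M')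
          - s ^ 2 * (M * M' * (κ - κ'))) / ((1 + M * s) * (1 + M' * s)) := by
    unfold filt
    have : 1 + M * s ≠ 0 := by linarith
    have : 1 + M' * s ≠ 0 := by linarith
    have : 1 + s * M ≠ 0 := by linarith
    have : 1 + s * M' ≠ 0 := by linarith
    field_simp
    ring
  have hdd : 9 / 10 ≤ (1 + M * s) * (1 + M' * s) := by nlinarith
  have e1 : |(M - M') * (1 - s ^ 2 * R)| ≤ D := by
    rw [abs_mul]
    have : |1 - s ^ 2 * R| ≤ 1 := by
      rw [abs_le]; constructor <;> nlinarith [sq_nonneg s]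
    nlinarith [abs_nonneg (M - M')]
  have e2 : |s * (κ * (M - M') + (κ - κ') * M')| ≤ 1 / 3 * D + Δ * (2 * ε * R) := by
    have h2 : |κ * (M - M') + (κ - κ') * M'| ≤ 1 / 3 * D + Δ * (2 * ε * R) := by
      refine (abs_add_le _ _).trans ?_
      rw [abs_mul, abs_mul]
      gcongr
    rw [abs_mul]; nlinarith [abs_nonneg (κ * (M - M') + (κ - κ') * M')]
  have e3 : |s ^ 2 * (M * M' * (κ - κ'))| ≤ 1 / 50 * (2 * ε * R) * Δ := by
    rw [abs_mul, abs_mul, abs_mul, abs_of_nonneg (sq_nonneg s)]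
    have h5 : |M| * |M'| ≤ 1 / 50 * (2 * ε * R) :=
      mul_le_mul (by linarith) hM' (abs_nonneg _) (by norm_num)
    have h6 : |M| * |M'| * |κ - κ'| ≤ 1 / 50 * (2 * ε * R) * Δ :=
      mul_le_mul h5 hΔ (abs_nonneg _) (by positivity)
    have h7 : 0 ≤ |M| * |M'| * |κ - κ'| := by positivity
    nlinarith
  rw [key, abs_div, abs_of_pos (show 0 < (1 + M * s) * (1 + M' * s) by linarith),
    div_le_iff₀ (by linarith), abs_mul, abs_of_pos hε]
  have e4 : |(M - M') * (1 - s ^ 2 * R) - s * (κ * (M - M') + (κ - κ') * M')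
          - s ^ 2 * (M * M' * (κ - κ'))| ≤ 4 / 3 * D + 51 / 50 * (2 * ε * R) * Δ := by
    refine (abs_sub _ _).trans ?_
    have := abs_sub ((M - M') * (1 - s ^ 2 * R)) (s * (κ * (M - M') + (κ - κ') * M'))
    linarith
  have e5 : ε * (2 * ε * R * Δ) = D / 2 := by rw [hD]; ring
  have e6 : ε * D ≤ 1 / 10 * D := by gcongr
  calc _ ≤ ε * (4 / 3 * D + 51 / 50 * (2 * ε * R) * Δ) := by gcongr
    _ = 4 / 3 * (ε * D) + 51 / 50 * (ε * (2 * ε * R * Δ)) := by ring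
    _ ≤ 9 / 10 * D := by rw [e5]; linarith
    _ ≤ _ := by nlinarith

lemma one_add_pos {ε R M s : ℝ} (hε : 0 < ε) (hε' : ε ≤ 1 / 10) (hR : 0 < R) (hR' : R ≤ 1 / 10)
    (hM : |M| ≤ 2 * ε * R) (hs : |s| ≤ 1) : 1 / 2 ≤ 1 + M * s := by
  have hεR : ε * R ≤ 1 / 100 := by nlinarith
  have hMs : |M * s| ≤ 1 / 50 := by
    rw [abs_mul]; nlinarith [abs_nonneg M, abs_nonneg s]
  linarith [(abs_le.mp hMs).1]

lemma gLaw_eq_hLaw {K : ℕ} (sv : Fin K → ℝ) (hsv : ∀ k, |sv k| ≤ 1) {ε R a b : ℝ}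
    (hε : 0 < ε) (hε' : ε ≤ 1 / 10) (hR : 0 < R) (hR' : R ≤ 1 / 10) (hb : b ≠ 0)
    (hκ : |a * b| ≤ 1 / 3) (hRe : R = (1 - a ^ 2) * b ^ 2 / 4) (n : ℕ) :
    ∀ (M : ℝ) (y : Fin n → Fin K), |M| ≤ 2 * ε * R →
      gLaw (mk sv ε a b) (fun x => if x = 0 then (1 + a) / 2 + M / b else (1 - a) / 2 - M / b) n y
        = hLaw sv ε R (a * b) n M y := by
  induction n with
  | zero => intro M y _; rw [gLaw_zero]; rfl
  | succ n ih =>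
    intro M y hM
    have hs := hsv (y 0)
    have hpos := one_add_pos hε hε' hR hR' hM hs
    have hne : 1 + M * sv (y 0) ≠ 0 := by linarith
    rw [gLaw_succ]
    rw [gLaw_lin (mk sv ε a b) _
      (fun x => if x = 0 then (1 + a) / 2 + filt ε R (a * b) M (sv (y 0)) / b
        else (1 - a) / 2 - filt ε R (a * b) M (sv (y 0)) / b)
      ((1 / (K : ℝ)) * (1 + M * sv (y 0))), ih _ _ (abs_filt_le hε hε' hR hR' hκ hM hs)]
    · rfl
    · simp only [Fin.sum_univ_two, emit, mk]
      simp
      field_simp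
      ring
    · intro c
      fin_cases c
      · simp only [Fin.sum_univ_two, emit, mk, transP, filt, hRe]
        simp
        field_simp
        ring
      · simp only [Fin.sum_univ_two, emit, mk, transP, filt, hRe]
        simp
        field_simp
        ring

lemma sum_cons {K n : ℕ} (F : Fin K → (Fin n → Fin K) → ℝ) :
    ∑ y : Fin (n + 1) → Fin K, F (y 0) (fun i => y i.succ) = ∑ k, ∑ z, F k z := by
  rw [← (Fin.consEquiv (fun _ => Fin K)).sum_comp, Fintype.sum_prod_type]
  simp [Fin.consEquiv]

section
variable {K : ℕ} (hK : 0 < K) (sv : Fin K → ℝ) (hsv : ∀ k, |sv k| ≤ 1) (hsum : ∑ k, sv k = 0)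

lemma hLaw_pos (hK : 0 < K) (hsv : ∀ k, |sv k| ≤ 1) {ε R κ : ℝ}
    (hε : 0 < ε) (hε' : ε ≤ 1 / 10) (hR : 0 < R) (hR' : R ≤ 1 / 10)
    (hκ : |κ| ≤ 1 / 3) (n : ℕ) :
    ∀ (M : ℝ) (y : Fin n → Fin K), |M| ≤ 2 * ε * R → 0 < hLaw sv ε R κ n M y := by
  induction n with
  | zero => intro M y _; exact one_pos
  | succ n ih =>
    intro M y hM
    have hs := hsv (y 0)
    have hpos := one_add_pos hε hε' hR hR' hM hs
    have h1 := ih _ (fun i => y i.succ) (abs_filt_le hε hε' hR hR' hκ hM hs)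
    have hK' : (0 : ℝ) < K := by exact_mod_cast hK
    have h2 : 0 < 1 + M * sv (y 0) := by linarith
    show 0 < (1 / (K : ℝ)) * (1 + M * sv (y 0)) * _
    positivity

lemma hLaw_sum (hK : 0 < K) (hsv : ∀ k, |sv k| ≤ 1) (hsum : ∑ k, sv k = 0) {ε R κ : ℝ}
    (hε : 0 < ε) (hε' : ε ≤ 1 / 10) (hR : 0 < R) (hR' : R ≤ 1 / 10)
    (hκ : |κ| ≤ 1 / 3) (n : ℕ) :
    ∀ (M : ℝ), |M| ≤ 2 * ε * R → ∑ y, hLaw sv ε R κ n M y = 1 := by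
  induction n with
  | zero => intro M _; simp [hLaw]
  | succ n ih =>
    intro M hM
    have hK' : (K : ℝ) ≠ 0 := by exact_mod_cast hK.ne'
    simp only [hLaw]
    rw [sum_cons (fun k z => (1 / (K : ℝ)) * (1 + M * sv k) *
      hLaw sv ε R κ n (filt ε R κ M (sv k)) z)]
    have : ∀ k : Fin K, ∑ z, (1 / (K : ℝ)) * (1 + M * sv k) *
      hLaw sv ε R κ n (filt ε R κ M (sv k)) z = (1 / (K : ℝ)) * (1 + M * sv k) := by
      intro k
      rw [← Finset.mul_sum, ih _ (abs_filt_le hε hε' hR hR' hκ hM (hsv k)), mul_one]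
    simp only [this]
    rw [← Finset.mul_sum, Finset.sum_add_distrib, ← Finset.mul_sum, hsum]
    simp [hK']

lemma chi_le (hK : 0 < K) (hsv : ∀ k, |sv k| ≤ 1) (hsum : ∑ k, sv k = 0) {ε R κ κ' D Δ : ℝ}
    (hε : 0 < ε) (hε' : ε ≤ 1 / 10) (hR : 0 < R) (hR' : R ≤ 1 / 10)
    (hκ : |κ| ≤ 1 / 3) (hκ' : |κ'| ≤ 1 / 3) (hΔ : |κ - κ'| ≤ Δ) (hD : D = 4 * ε ^ 2 * R * Δ)
    (n : ℕ) :
    ∀ (M M' : ℝ), |M| ≤ 2 * ε * R → |M'| ≤ 2 * ε * R → |M - M'| ≤ D →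
      ∑ y, hLaw sv ε R κ n M y ^ 2 / hLaw sv ε R κ' n M' y ≤ (1 + 2 * D ^ 2) ^ n := by
  induction n with
  | zero => intro M M' _ _ _; simp [hLaw]
  | succ n ih =>
    intro M M' hM hM' hMM
    have hK' : (0 : ℝ) < K := by exact_mod_cast hK
    have hK0 : (K : ℝ) ≠ 0 := hK'.ne'
    simp only [hLaw]
    rw [sum_cons (fun k z => ((1 / (K : ℝ)) * (1 + M * sv k) *
      hLaw sv ε R κ n (filt ε R κ M (sv k)) z) ^ 2 / ((1 / (K : ℝ)) * (1 + M' * sv k) *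
      hLaw sv ε R κ' n (filt ε R κ' M' (sv k)) z))]
    have hpos : ∀ k, 1 / 2 ≤ 1 + M' * sv k := fun k =>
      one_add_pos hε hε' hR hR' hM' (hsv k)
    have h1 : ∀ k : Fin K, ∑ z, ((1 / (K : ℝ)) * (1 + M * sv k) *
      hLaw sv ε R κ n (filt ε R κ M (sv k)) z) ^ 2 / ((1 / (K : ℝ)) * (1 + M' * sv k) *
      hLaw sv ε R κ' n (filt ε R κ' M' (sv k)) z)
        ≤ (1 / (K : ℝ)) * ((1 + M * sv k) ^ 2 / (1 + M' * sv k)) * (1 + 2 * D ^ 2) ^ n := by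
      intro k
      have hp := hpos k
      calc _ = (1 / (K : ℝ)) * ((1 + M * sv k) ^ 2 / (1 + M' * sv k)) *
            ∑ z, hLaw sv ε R κ n (filt ε R κ M (sv k)) z ^ 2 /
              hLaw sv ε R κ' n (filt ε R κ' M' (sv k)) z := by
            rw [Finset.mul_sum]
            refine Finset.sum_congr rfl fun z _ => ?_
            have e1 : 1 + M' * sv k ≠ 0 := by linarith
            have e2 := (hLaw_pos sv hK hsv hε hε' hR hR' hκ' n _ z
              (abs_filt_le hε hε' hR hR' hκ' hM' (hsv k))).ne'
            field_simp
        _ ≤ _ := by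
            refine mul_le_mul_of_nonneg_left ?_ ?_
            · exact ih _ _ (abs_filt_le hε hε' hR hR' hκ hM (hsv k))
                (abs_filt_le hε hε' hR hR' hκ' hM' (hsv k))
                (filt_sub_le hε hε' hR hR' hκ hM hM' (hsv k) hΔ hD hMM)
            · have : 0 < 1 + M' * sv k := by linarith
              positivity
    have h2 : ∀ k : Fin K, (1 + M * sv k) ^ 2 / (1 + M' * sv k)
        ≤ (1 + 2 * D ^ 2) + (2 * M - M') * sv k := by
      intro k
      have hp := hpos k
      have hs2 : sv k ^ 2 ≤ 1 := by rw [← sq_abs]; nlinarith [hsv k, abs_nonneg (sv k)]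
      have hm2 : (M - M') ^ 2 ≤ D ^ 2 := by
        rw [← sq_abs]; exact pow_le_pow_left₀ (abs_nonneg _) hMM 2
      have hm3 : (M - M') ^ 2 * sv k ^ 2 ≤ D ^ 2 := by
        nlinarith [sq_nonneg (M - M'), sq_nonneg (sv k)]
      have hpp : 0 < 1 + M' * sv k := by linarith
      have : (1 + M * sv k) ^ 2 / (1 + M' * sv k)
          = 1 + (2 * M - M') * sv k + (M - M') ^ 2 * sv k ^ 2 / (1 + M' * sv k) := by
        have e1 : 1 + M' * sv k ≠ 0 := hpp.ne'
        have e2 : 1 + sv k * M' ≠ 0 := by linarith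
        field_simp
        ring
      rw [this]
      have : (M - M') ^ 2 * sv k ^ 2 / (1 + M' * sv k) ≤ 2 * D ^ 2 := by
        rw [div_le_iff₀ hpp]
        nlinarith [sq_nonneg D]
      linarith
    calc _ ≤ ∑ k, (1 / (K : ℝ)) * ((1 + 2 * D ^ 2) + (2 * M - M') * sv k)
              * (1 + 2 * D ^ 2) ^ n := by
          refine Finset.sum_le_sum fun k _ => (h1 k).trans ?_
          have := h2 k
          gcongr
      _ = _ := by
          rw [← Finset.sum_mul, ← Finset.mul_sum, Finset.sum_add_distrib, ← Finset.mul_sum, hsum]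
          simp
          field_simp
          ring
end

/-- Two-point bound from a chi-square bound. -/
lemma lecam {α : Type*} [Fintype α] (P P' : α → ℝ) (hP : ∀ y, 0 ≤ P y) (hP' : ∀ y, 0 < P' y)
    (h1 : ∑ y, P y = 1) (h1' : ∑ y, P' y = 1) (hchi : ∑ y, P y ^ 2 / P' y ≤ 2) :
    1 / 2 ≤ ∑ y, min (P y) (P' y) := by
  have hc : ∑ y, (P y - P' y) ^ 2 / P' y ≤ 1 := by
    have : ∀ y, (P y - P' y) ^ 2 / P' y = P y ^ 2 / P' y - 2 * P y + P' y := by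
      intro y
      have := (hP' y).ne'
      field_simp
      ring
    simp only [this]
    rw [Finset.sum_add_distrib, Finset.sum_sub_distrib, ← Finset.mul_sum, h1, h1']
    linarith
  have hab : ∀ y, |P y - P' y| ≤ ((P y - P' y) ^ 2 / P' y + P' y) / 2 := by
    intro y
    have hp := hP' y
    rw [← sq_abs]
    have : |P y - P' y| ^ 2 / P' y + P' y - 2 * |P y - P' y|
        = (|P y - P' y| - P' y) ^ 2 / P' y := by
      field_simp
      ring
    have h0 : 0 ≤ (|P y - P' y| - P' y) ^ 2 / P' y := by positivity
    linarith
  have hmin : ∀ y, (P y + P' y - ((P y - P' y) ^ 2 / P' y + P' y) / 2) / 2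
      ≤ min (P y) (P' y) := by
    intro y
    have := hab y
    have h2 := le_abs_self (P y - P' y)
    have h3 := neg_abs_le (P y - P' y)
    rcases le_total (P y) (P' y) with h | h
    · rw [min_eq_left h]; rw [abs_of_nonpos (by linarith)] at this; linarith
    · rw [min_eq_right h]; rw [abs_of_nonneg (by linarith)] at this; linarith
  calc (1 : ℝ) / 2 ≤ ∑ y, (P y + P' y - ((P y - P' y) ^ 2 / P' y + P' y) / 2) / 2 := by
        rw [← Finset.sum_div, Finset.sum_sub_distrib, Finset.sum_add_distrib, ← Finset.sum_div,
          Finset.sum_add_distrib, h1, h1']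
        linarith
    _ ≤ _ := Finset.sum_le_sum fun y _ => hmin y

lemma exists_sign (K : ℕ) : ∃ sv : Fin K → ℝ, (∀ k, |sv k| ≤ 1) ∧ ∑ k, sv k = 0 ∧
    ∑ k, sv k ^ 2 = 2 * ((K / 2 : ℕ) : ℝ) := by
  induction K using Nat.twoStepInduction with
  | zero => exact ⟨fun _ => 0, by simp, by simp, by simp⟩
  | one => exact ⟨fun _ => 0, by simp, by simp, by simp⟩
  | more K ih _ =>
    obtain ⟨sv, h1, h2, h3⟩ := ih
    refine ⟨Fin.cons 1 (Fin.cons (-1) sv), ?_, ?_, ?_⟩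
    · intro k
      refine Fin.cases ?_ (fun k => ?_) k
      · simp
      · refine Fin.cases ?_ (fun k => ?_) k
        · simp
        · simpa using h1 k
    · simp [Fin.sum_univ_succ, h2]
    · rw [Fin.sum_univ_succ, Fin.sum_univ_succ]
      have : (K + 2) / 2 = K / 2 + 1 := by omega
      rw [this]
      simp only [Fin.cons_zero, Fin.cons_succ, h3]
      push_cast
      ring

lemma unpack_pack {K : ℕ} (θ : Param K) (h1 : θ.p + θ.q ≠ 0)
    (h2 : enormF (fun k => θ.f0 k - θ.f1 k) ≠ 0) : unpack (pack θ) = θ := by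
  rcases θ with ⟨p, q, f0, f1⟩
  simp only [unpack, pack, phiOf, psiOf] at *
  generalize enormF (fun k => f0 k - f1 k) = e at *
  congr 1
  · field_simp
    ring
  · field_simp
    ring
  · funext k
    field_simp
    ring
  · funext k
    field_simp
    ring

lemma unpack_pack_of_mem {K : ℕ} {L δ ε ζ : ℝ} (hζ : 0 < ζ) {θ : Param K}
    (h : θ ∈ ThetaL K L δ ε ζ) : unpack (pack θ) = θ := by
  obtain ⟨⟨⟨hp, hq, -, -⟩, -, -, -, he⟩, -⟩ := h
  exact unpack_pack θ (by linarith [hp.1, hq.1]) (by linarith)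

lemma density_le_one {K : ℕ} {f : Fin K → ℝ} (h : IsDensity f) (k : Fin K) : f k ≤ 1 := by
  rw [← h.2]
  exact Finset.single_le_sum (fun i _ => h.1 i) (Finset.mem_univ k)

lemma pLaw_bounds {K : ℕ} {θ : Param K} (h : Valid θ) (n : ℕ) (y : Fin n → Fin K) :
    0 ≤ pLaw θ n y ∧ pLaw θ n y ≤ 2 ^ n := by
  obtain ⟨hp, hq, h0, h1⟩ := h
  have hp0 := hp.1
  have hp1 := hp.2
  have hq0 := hq.1
  have hq1 := hq.2
  have hi : ∀ a, 0 ≤ initD θ a ∧ initD θ a ≤ 1 := by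
    intro a
    unfold initD
    split_ifs
    · exact ⟨by positivity, by rw [div_le_one (by linarith)]; linarith⟩
    · exact ⟨by positivity, by rw [div_le_one (by linarith)]; linarith⟩
  have ht : ∀ a b, 0 ≤ transP θ a b ∧ transP θ a b ≤ 1 := by
    intro a b
    unfold transP
    split_ifs <;> constructor <;> linarith
  have he : ∀ a k, 0 ≤ emit θ a k ∧ emit θ a k ≤ 1 := by
    intro a k
    unfold emit
    split_ifs
    · exact ⟨h0.1 k, density_le_one h0 k⟩
    · exact ⟨h1.1 k, density_le_one h1 k⟩
  have hterm : ∀ x : Fin n → Fin 2, ∀ i : Fin n,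
      0 ≤ (if (i : ℕ) = 0 then initD θ (x i)
          else transP θ (x ⟨(i : ℕ) - 1, lt_of_le_of_lt (Nat.sub_le _ _) i.isLt⟩) (x i)) ∧
      (if (i : ℕ) = 0 then initD θ (x i)
          else transP θ (x ⟨(i : ℕ) - 1, lt_of_le_of_lt (Nat.sub_le _ _) i.isLt⟩) (x i)) ≤ 1 := by
    intro x i
    split_ifs
    · exact hi _
    · exact ht _ _
  unfold pLaw
  constructor
  · exact Finset.sum_nonneg fun x _ => mul_nonneg
      (Finset.prod_nonneg fun i _ => (hterm x i).1) (Finset.prod_nonneg fun i _ => (he _ _).1)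
  · calc _ ≤ ∑ x : Fin n → Fin 2, (1 : ℝ) := by
          refine Finset.sum_le_sum fun x _ => ?_
          exact mul_le_one₀ (Finset.prod_le_one (fun i _ => (hterm x i).1) fun i _ => (hterm x i).2)
            (Finset.prod_nonneg fun i _ => (he _ _).1)
            (Finset.prod_le_one (fun i _ => (he _ _).1) fun i _ => (he _ _).2)
      _ = 2 ^ n := by simp

lemma probOf_le {K : ℕ} {θ : Param K} (h : Valid θ) (n : ℕ) (E : (Fin n → Fin K) → Prop) :
    probOf θ n E ≤ ∑ _y : Fin n → Fin K, (2 : ℝ) ^ n := by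
  classical
  unfold probOf
  refine Finset.sum_le_sum fun y _ => ?_
  have := pLaw_bounds h n y
  split_ifs
  · exact this.2
  · positivity

lemma probOf_nonneg {K : ℕ} {θ : Param K} (h : Valid θ) (n : ℕ) (E : (Fin n → Fin K) → Prop) :
    0 ≤ probOf θ n E := by
  classical
  unfold probOf
  refine Finset.sum_nonneg fun y _ => ?_
  have := pLaw_bounds h n y
  split_ifs
  · exact this.1
  · exact le_rfl

lemma le_sup {K : ℕ} {L δ ε ζ : ℝ} (hζ : 0 < ζ) {θ : Param K} (h : θ ∈ ThetaL K L δ ε ζ) (n : ℕ)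
    (E : PP K → (Fin n → Fin K) → Prop) :
    probOf θ n (E (pack θ)) ≤ ⨆ π ∈ PhiL K L δ ε ζ, probOf (unpack π) n (E π) := by
  have hb : BddAbove (Set.range fun π => ⨆ (_ : π ∈ PhiL K L δ ε ζ), probOf (unpack π) n (E π)) := by
    refine ⟨∑ _y : Fin n → Fin K, (2 : ℝ) ^ n, ?_⟩
    rintro _ ⟨π, rfl⟩
    have h0 : (0 : ℝ) ≤ ∑ _y : Fin n → Fin K, (2 : ℝ) ^ n :=
      Finset.sum_nonneg fun _ _ => by positivity
    refine Real.iSup_le (fun hπ => ?_) h0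
    obtain ⟨θ', hθ', rfl⟩ := hπ
    rw [unpack_pack_of_mem hζ hθ']
    exact probOf_le hθ'.1.1 n _
  have hmem : pack θ ∈ PhiL K L δ ε ζ := ⟨θ, h, rfl⟩
  have := le_ciSup hb (pack θ)
  simp only [hmem, ciSup_pos, unpack_pack_of_mem hζ h] at this
  exact this

lemma two_point {K : ℕ} {L δ ε ζ : ℝ} (hζ : 0 < ζ) {θ θ' : Param K} (h : θ ∈ ThetaL K L δ ε ζ)
    (h' : θ' ∈ ThetaL K L δ ε ζ) (n : ℕ)
    (hmin : 1 / 2 ≤ ∑ y, min (pLaw θ n y) (pLaw θ' n y))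
    (E : PP K → (Fin n → Fin K) → Prop) (hE : ∀ y, E (pack θ) y ∨ E (pack θ') y) :
    1 / 4 ≤ ⨆ π ∈ PhiL K L δ ε ζ, probOf (unpack π) n (E π) := by
  classical
  have e1 := le_sup hζ h n E
  have e2 := le_sup hζ h' n E
  have e3 : ∑ y, min (pLaw θ n y) (pLaw θ' n y)
      ≤ probOf θ n (E (pack θ)) + probOf θ' n (E (pack θ')) := by
    unfold probOf
    rw [← Finset.sum_add_distrib]
    refine Finset.sum_le_sum fun y _ => ?_
    have b1 := (pLaw_bounds h.1.1 n y).1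
    have b2 := (pLaw_bounds h'.1.1 n y).1
    have m1 := min_le_left (pLaw θ n y) (pLaw θ' n y)
    have m2 := min_le_right (pLaw θ n y) (pLaw θ' n y)
    rcases hE y with hy | hy
    · rw [if_pos hy]; split_ifs <;> linarith
    · rw [if_pos hy]; split_ifs <;> linarith
  linarith

lemma mk_mem {K : ℕ} (hK : 0 < K) (sv : Fin K → ℝ) (hsv : ∀ k, |sv k| ≤ 1)
    (hsum : ∑ k, sv k = 0) {L δ ε ζ a b : ℝ} (hL : L ≤ 1 / 3) (hδ : 0 < δ) (hε : 0 < ε)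
    (hε' : ε ≤ 1 / 10) (ha : 0 ≤ a) (hb : 0 < b) (hb' : b ≤ 1 / 3)
    (hV : 5 * δ ≤ 1 - a ^ 2) (hbζ : ζ ≤ b * Real.sqrt (∑ k, sv k ^ 2) / K) :
    mk sv ε a b ∈ ThetaL K L δ ε ζ := by
  have ha1 : a < 1 := by nlinarith
  have hK' : (0 : ℝ) < K := by exact_mod_cast hK
  have h1a : 5 * δ ≤ (1 - a) * 2 := by nlinarith
  have hp : δ ≤ (1 - ε) * (1 - a) / 2 := by nlinarith
  have hq : δ ≤ (1 - ε) * (1 + a) / 2 := by nlinarith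
  have hbs : ∀ k, |b * sv k| ≤ 1 / 3 := by
    intro k
    rw [abs_mul, abs_of_pos hb]
    nlinarith [hsv k, abs_nonneg (sv k)]
  have h1 : 1 - (1 - ε) * (1 - a) / 2 - (1 - ε) * (1 + a) / 2 = ε := by ring
  refine ⟨⟨⟨⟨?_, ?_⟩, ⟨?_, ?_⟩, ⟨?_, ?_⟩, ⟨?_, ?_⟩⟩, hp, hq, ?_, ?_⟩, ?_⟩
  · exact hδ.trans_le hp
  · simp only [mk]; nlinarith
  · exact hδ.trans_le hq
  · simp only [mk]; nlinarith
  · intro k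
    have := abs_le.mp (hbs k)
    have h0 : 0 ≤ 1 + (1 - a) / 2 * b * sv k := by nlinarith
    simp only [mk]
    positivity
  · simp only [mk]
    rw [← Finset.mul_sum, Finset.sum_add_distrib, ← Finset.mul_sum, hsum]
    simp [hK'.ne']
  · intro k
    have := abs_le.mp (hbs k)
    have h0 : 0 ≤ 1 - (1 + a) / 2 * b * sv k := by nlinarith
    simp only [mk]
    positivity
  · simp only [mk]
    rw [← Finset.mul_sum, Finset.sum_sub_distrib, ← Finset.mul_sum, hsum]
    simp [hK'.ne']
  · simp only [mk]
    rw [h1, abs_of_pos hε]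
  · have : enormF (fun k => (mk sv ε a b).f0 k - (mk sv ε a b).f1 k)
        = b * Real.sqrt (∑ k, sv k ^ 2) / K := by
      unfold enormF
      have : ∀ k, ((mk sv ε a b).f0 k - (mk sv ε a b).f1 k) ^ 2 = (b / K) ^ 2 * sv k ^ 2 := by
        intro k
        simp only [mk]
        ring
      simp only [this]
      rw [← Finset.mul_sum, Real.sqrt_mul (sq_nonneg _), Real.sqrt_sq (by positivity)]
      ring
    rw [this]
    exact hbζ
  · show L ≤ 1 - |1 - (mk sv ε a b).p - (mk sv ε a b).q|
    simp only [mk]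
    rw [h1, abs_of_pos hε]
    linarith

lemma pack_mk {K : ℕ} (sv : Fin K → ℝ) {ε a b : ℝ} (hε' : ε ≤ 1 / 10) :
    (pack (mk sv ε a b)).1.1 = a := by
  simp only [pack, phiOf, mk]
  have : 1 - ε ≠ 0 := by linarith
  have h2 : (1 - ε) * (1 - a) / 2 + (1 - ε) * (1 + a) / 2 = 1 - ε := by ring
  rw [h2]
  field_simp
  ring

lemma pLaw_mk {K : ℕ} (sv : Fin K → ℝ) (hsv : ∀ k, |sv k| ≤ 1) {ε R a b : ℝ}
    (hε : 0 < ε) (hε' : ε ≤ 1 / 10) (hR : 0 < R) (hR' : R ≤ 1 / 10) (hb : b ≠ 0)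
    (hκ : |a * b| ≤ 1 / 3) (hRe : R = (1 - a ^ 2) * b ^ 2 / 4) (n : ℕ) (y : Fin n → Fin K) :
    pLaw (mk sv ε a b) n y = hLaw sv ε R (a * b) n 0 y := by
  rw [← gLaw_eq_hLaw sv hsv hε hε' hR hR' hb hκ hRe n 0 y (by simp; positivity)]
  have : initD (mk sv ε a b)
      = fun x => if x = 0 then (1 + a) / 2 + 0 / b else (1 - a) / 2 - 0 / b := by
    funext x
    unfold initD
    have : 1 - ε ≠ 0 := by linarith
    have h2 : (1 - ε) * (1 - a) / 2 + (1 - ε) * (1 + a) / 2 = 1 - ε := by ring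
    simp only [mk]
    rw [h2]
    split_ifs
    · field_simp
      ring
    · field_simp
      ring
  rw [← this]
  rfl

/-- Laws of the two hypotheses overlap. -/
lemma overlap {K : ℕ} (hK : 0 < K) (sv : Fin K → ℝ) (hsv : ∀ k, |sv k| ≤ 1)
    (hsum : ∑ k, sv k = 0) {ε R a b a' b' D Δ : ℝ}
    (hε : 0 < ε) (hε' : ε ≤ 1 / 10) (hR : 0 < R) (hR' : R ≤ 1 / 10) (hb : b ≠ 0) (hb' : b' ≠ 0)
    (hκ : |a * b| ≤ 1 / 3) (hκ' : |a' * b'| ≤ 1 / 3) (hRe : R = (1 - a ^ 2) * b ^ 2 / 4)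
    (hRe' : R = (1 - a' ^ 2) * b' ^ 2 / 4) (hΔ : |a * b - a' * b'| ≤ Δ)
    (hD : D = 4 * ε ^ 2 * R * Δ) (n : ℕ) (hn : n * (2 * D ^ 2) ≤ 1 / 2) :
    1 / 2 ≤ ∑ y, min (pLaw (mk sv ε a b) n y) (pLaw (mk sv ε a' b') n y) := by
  have h0 : |(0 : ℝ)| ≤ 2 * ε * R := by simp; positivity
  simp only [pLaw_mk sv hsv hε hε' hR hR' hb hκ hRe, pLaw_mk sv hsv hε hε' hR hR' hb' hκ' hRe']
  have hΔ0 : 0 ≤ Δ := (abs_nonneg _).trans hΔ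
  refine lecam _ _ (fun y => (hLaw_pos sv hK hsv hε hε' hR hR' hκ n 0 y h0).le)
    (fun y => hLaw_pos sv hK hsv hε hε' hR hR' hκ' n 0 y h0)
    (hLaw_sum sv hK hsv hsum hε hε' hR hR' hκ n 0 h0)
    (hLaw_sum sv hK hsv hsum hε hε' hR hR' hκ' n 0 h0)
    ((chi_le sv hK hsv hsum hε hε' hR hR' hκ hκ' hΔ hD n 0 0 h0 h0
      (by rw [hD]; simp; positivity)).trans ?_)
  calc (1 + 2 * D ^ 2) ^ n ≤ (Real.exp (2 * D ^ 2)) ^ n := by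
        gcongr
        linarith [Real.add_one_le_exp (2 * D ^ 2)]
    _ = Real.exp (n * (2 * D ^ 2)) := by rw [← Real.exp_nat_mul]
    _ ≤ Real.exp (1 / 2) := Real.exp_le_exp.mpr hn
    _ ≤ 2 := by
        have := Real.exp_bound' (x := 1 / 2) (by norm_num) (by norm_num) (n := 3) (by norm_num)
        refine this.trans ?_
        norm_num [Finset.sum_range_succ, Nat.factorial]

set_option maxHeartbeats 1000000 in
theorem statement14 (K : ℕ) (hK : 2 ≤ K) :
    ∃ c ε₀ : ℝ, 0 < c ∧ 0 < ε₀ ∧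
      ∀ (L δ ε ζ : ℝ) (n : ℕ),
        0 < L → L ≤ 1 / 3 →
        δ ∈ Set.Ioo (0 : ℝ) 1 → δ ≤ 1 / 6 →
        ε ∈ Set.Ioo (0 : ℝ) 1 → ε ≤ ε₀ →
        0 < ζ → ζ ≤ Real.sqrt (2 * ((K / 2 : ℕ) : ℝ)) / (4 * K) →
        1 ≤ n * δ ^ 2 * ε ^ 4 * ζ ^ 6 →
        (∀ est : (Fin n → Fin K) → ℝ,
          1 / 4 ≤ ⨆ π ∈ PhiL K L δ ε ζ,
            probOf (unpack π) n (fun y =>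
              c / (n * ε ^ 4 * ζ ^ 6)
                ≤ min (|est y - π.1.1| ^ 2) (|est y + π.1.1| ^ 2)))
        ∧ (∀ est : (Fin n → Fin K) → ℝ,
          1 / 4 ≤ ⨆ π ∈ PhiL K L δ ε ζ,
            probOf (unpack π) n (fun y =>
              2 * c / (n * δ ^ 2 * ε ^ 4 * ζ ^ 6)
                ≤ |(1 - (est y) ^ 2) / (1 - π.1.1 ^ 2) - 1| ^ 2)) := by
  obtain ⟨sv, hsv, hsum, hsq⟩ := exists_sign K
  have hK' : (0 : ℝ) < K := by exact_mod_cast (by omega : 0 < K)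
  have hN1 : (1 : ℝ) ≤ ((K / 2 : ℕ) : ℝ) := by exact_mod_cast (by omega : 1 ≤ K / 2)
  have hN2 : 2 * ((K / 2 : ℕ) : ℝ) ≤ K := by exact_mod_cast (by omega : 2 * (K / 2) ≤ K)
  obtain ⟨g, hg⟩ : ∃ g, g = Real.sqrt (2 * ((K / 2 : ℕ) : ℝ)) / K := ⟨_, rfl⟩
  have hg0 : 0 < g := by
    rw [hg]
    have : 0 < Real.sqrt (2 * ((K / 2 : ℕ) : ℝ)) := Real.sqrt_pos.mpr (by linarith)
    positivity
  have hg1 : g ≤ 1 := by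
    rw [hg, div_le_one hK']
    have hK1 : (2 : ℝ) ≤ K := by exact_mod_cast hK
    exact (Real.sqrt_le_sqrt hN2).trans (Real.sqrt_le_iff.mpr ⟨by linarith, by nlinarith⟩)
  refine ⟨g ^ 6 / 100000, 1 / 10, by positivity, by norm_num, ?_⟩
  intro L δ ε ζ n hL hL' hδ hδ' hε hε' hζ hζ' hn
  have hδ0 := hδ.1
  have hε0 := hε.1
  -- rescaled amplitude
  obtain ⟨b, hb⟩ : ∃ b, b = ζ / g := ⟨_, rfl⟩
  have hb0 : 0 < b := by rw [hb]; positivity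
  have hζb : ζ = b * g := by rw [hb]; field_simp
  have hb1 : b ≤ 1 / 4 := by
    rw [hb, div_le_iff₀ hg0, hg]
    refine hζ'.trans (le_of_eq ?_)
    ring
  have hn0 : (0 : ℝ) < n := by
    rcases Nat.eq_zero_or_pos n with h | h
    · subst h; norm_num at hn
    · exact_mod_cast h
  have hnb : 1 ≤ n * δ ^ 2 * ε ^ 4 * b ^ 6 := by
    refine hn.trans ?_
    have : ζ ≤ b := by rw [hζb]; linarith [mul_le_mul_of_nonneg_left hg1 hb0.le]
    gcongr
  -- relative perturbation
  obtain ⟨X, hX⟩ : ∃ X, X = n * δ ^ 2 * ε ^ 4 * b ^ 6 := ⟨_, rfl⟩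
  rw [← hX] at hnb
  obtain ⟨t, ht⟩ : ∃ t, t = Real.sqrt (8 / 100000 / X) := ⟨_, rfl⟩
  have hX0 : 0 < X := by linarith
  have ht0 : 0 < t := by rw [ht]; exact Real.sqrt_pos.mpr (by positivity)
  have ht2 : t ^ 2 = 8 / 100000 / X := by rw [ht]; exact Real.sq_sqrt (by positivity)
  have htX : X * t ^ 2 = 8 / 100000 := by rw [ht2]; field_simp
  have ht1 : t ≤ 1 / 100 := by
    have : t ^ 2 ≤ (1 / 100) ^ 2 := by
      linarith [mul_le_mul_of_nonneg_right hnb (sq_nonneg t)]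
    exact le_of_sq_le_sq this (by norm_num)
  -- the two values of `φ₁`
  obtain ⟨a, ha⟩ : ∃ a, a = Real.sqrt (1 - 5 * δ * (1 + t) ^ 2) := ⟨_, rfl⟩
  obtain ⟨a', ha'⟩ : ∃ a', a' = Real.sqrt (1 - 5 * δ) := ⟨_, rfl⟩
  have htt : (1 + t) ^ 2 ≤ 11 / 10 := by
    have : (1 + t) ^ 2 ≤ (1 + 1 / 100) ^ 2 := by gcongr
    linarith
  have haV : a ^ 2 = 1 - 5 * δ * (1 + t) ^ 2 := by
    rw [ha]; refine Real.sq_sqrt ?_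
    have : δ * (1 + t) ^ 2 ≤ 1 / 6 * (11 / 10) :=
      mul_le_mul hδ' htt (by positivity) (by norm_num)
    linarith
  have haV' : a' ^ 2 = 1 - 5 * δ := by
    rw [ha']; exact Real.sq_sqrt (by linarith)
  have ha0 : 0 ≤ a := by rw [ha]; exact Real.sqrt_nonneg _
  have ha0' : 0 ≤ a' := by rw [ha']; exact Real.sqrt_nonneg _
  have hδt2 : 0 < δ * (1 + t) ^ 2 := by positivity
  have ha1 : a ≤ 1 := by
    refine le_of_sq_le_sq ?_ zero_le_one
    rw [haV]; linarith
  have ha1' : a' ≤ 1 := by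
    refine le_of_sq_le_sq ?_ zero_le_one
    rw [haV']; linarith
  have ha2' : 2 / 5 ≤ a' := by
    refine le_of_sq_le_sq ?_ ha0'
    rw [haV']; linarith
  have hδt : 0 < δ * t := by positivity
  have hdiff : (a' - a) * (a' + a) = 5 * δ * t * (2 + t) := by
    have : (a' - a) * (a' + a) = a' ^ 2 - a ^ 2 := by ring
    rw [this, haV, haV']; ring
  have hlt : 0 < a' - a := by
    have h1 : 0 < (a' - a) * (a' + a) := by rw [hdiff]; positivity
    exact pos_of_mul_pos_left h1 (by linarith)
  have hlow : 5 * (δ * t) ≤ a' - a := by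
    have h1 : (a' - a) * (a' + a) ≤ (a' - a) * 2 :=
      mul_le_mul_of_nonneg_left (by linarith) hlt.le
    have h2 : 0 < δ * t * t := by positivity
    linarith
  have hup : a' - a ≤ 5 * t := by
    have h1 : (a' - a) * (2 / 5) ≤ (a' - a) * (a' + a) :=
      mul_le_mul_of_nonneg_left (by linarith) hlt.le
    have h2 : δ * t ≤ 1 / 6 * t := mul_le_mul_of_nonneg_right hδ' ht0.le
    have h3 : δ * t * (2 + t) ≤ 1 / 6 * t * (201 / 100) :=
      mul_le_mul h2 (by linarith) (by positivity) (by positivity)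
    linarith
  have hbt : b * (1 + t) ≤ 1 / 3 := by
    have : b * (1 + t) ≤ 1 / 4 * (1 + 1 / 100) :=
      mul_le_mul hb1 (by linarith) (by positivity) (by norm_num)
    linarith
  have hbt0 : 0 < b * (1 + t) := by positivity
  -- membership
  have hm : mk sv ε a b ∈ ThetaL K L δ ε ζ := by
    refine mk_mem (by omega) sv hsv hsum hL' hδ0 hε0 hε' ha0 hb0 (by linarith) ?_ ?_
    · rw [haV]
      have : 0 < δ * (2 * t + t ^ 2) := by positivity
      linarith
    · rw [hsq, hζb, hg]; exact le_of_eq (by ring)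
  have hm' : mk sv ε a' (b * (1 + t)) ∈ ThetaL K L δ ε ζ := by
    refine mk_mem (by omega) sv hsv hsum hL' hδ0 hε0 hε' ha0' (by positivity) hbt ?_ ?_
    · rw [haV']; linarith
    · rw [hsq, hζb]
      have : b * (1 + t) * Real.sqrt (2 * ((K / 2 : ℕ) : ℝ)) / K = b * g * (1 + t) := by
        rw [hg]; ring
      rw [this]
      linarith [mul_pos (mul_pos hb0 hg0) ht0]
  -- overlap
  have hmin : 1 / 2 ≤ ∑ y, min (pLaw (mk sv ε a b) n y) (pLaw (mk sv ε a' (b * (1 + t))) n y) := by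
    obtain ⟨R, hR⟩ : ∃ R, R = 5 * δ * (1 + t) ^ 2 * b ^ 2 / 4 := ⟨_, rfl⟩
    have hR2 : R ≤ 2 * δ * b ^ 2 := by
      rw [hR]
      have : δ * b ^ 2 * (1 + t) ^ 2 ≤ δ * b ^ 2 * (11 / 10) := by gcongr
      have : 0 < δ * b ^ 2 := by positivity
      linarith
    have hR0 : 0 < R := by rw [hR]; positivity
    refine overlap (R := R) (D := 4 * ε ^ 2 * R * (6 * b * t)) (Δ := 6 * b * t) (by omega)
      sv hsv hsum hε0 hε' hR0 ?_ hb0.ne' hbt0.ne' ?_ ?_ ?_ ?_ ?_ rfl n ?_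
    · have h1 : b ^ 2 ≤ (1 / 4) ^ 2 := by gcongr
      have h2 : δ * b ^ 2 ≤ 1 / 6 * (1 / 4) ^ 2 :=
        mul_le_mul hδ' h1 (by positivity) (by norm_num)
      linarith
    · rw [abs_of_nonneg (mul_nonneg ha0 hb0.le)]
      linarith [mul_le_mul_of_nonneg_right ha1 hb0.le]
    · rw [abs_of_nonneg (mul_nonneg ha0' hbt0.le)]
      linarith [mul_le_mul_of_nonneg_right ha1' hbt0.le]
    · rw [hR, haV]; ring
    · rw [hR, haV']; ring
    · have : a * b - a' * (b * (1 + t)) = -(b * ((a' - a) + a' * t)) := by ring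
      have h0 : 0 ≤ a' * t := mul_nonneg ha0' ht0.le
      rw [this, abs_neg, abs_of_nonneg (mul_nonneg hb0.le (by linarith))]
      have : (a' - a) + a' * t ≤ 6 * t := by
        linarith [mul_le_mul_of_nonneg_right ha1' ht0.le]
      linarith [mul_le_mul_of_nonneg_left this hb0.le]
    · have e1 : 4 * ε ^ 2 * R * (6 * b * t) ≤ 4 * ε ^ 2 * (2 * δ * b ^ 2) * (6 * b * t) := by
        gcongr
      have e2 : (4 * ε ^ 2 * R * (6 * b * t)) ^ 2
          ≤ (4 * ε ^ 2 * (2 * δ * b ^ 2) * (6 * b * t)) ^ 2 := by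
        gcongr
      calc (n : ℝ) * (2 * (4 * ε ^ 2 * R * (6 * b * t)) ^ 2)
          ≤ n * (2 * (4 * ε ^ 2 * (2 * δ * b ^ 2) * (6 * b * t)) ^ 2) := by gcongr
        _ = 4608 * (X * t ^ 2) := by rw [hX]; ring
        _ ≤ 1 / 2 := by rw [htX]; norm_num
  constructor
  · intro est
    refine two_point hζ hm hm' n hmin (fun π y => g ^ 6 / 100000 / (n * ε ^ 4 * ζ ^ 6)
                ≤ min (|est y - π.1.1| ^ 2) (|est y + π.1.1| ^ 2)) ?_
    intro y
    simp only [pack_mk sv hε']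
    have hthr : g ^ 6 / 100000 / (n * ε ^ 4 * ζ ^ 6) = (δ * t) ^ 2 / 8 := by
      rw [mul_pow, ht2, hX, hζb]
      field_simp
      try norm_num
    rw [hthr]
    by_contra hcon
    push Not at hcon
    obtain ⟨c1, c2⟩ := hcon
    have hab : ∀ z : ℝ, 0 ≤ z → min (|est y - z| ^ 2) (|est y + z| ^ 2) < (δ * t) ^ 2 / 8 →
        |(|est y|) - z| < δ * t := by
      intro z hz hlt
      have h3 : (|est y| - z) ^ 2 < (δ * t) ^ 2 := by
        have h4 : (|est y| - z) ^ 2 ≤ min (|est y - z| ^ 2) (|est y + z| ^ 2) := by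
          rw [sq_abs, sq_abs]
          have h5 : est y ≤ |est y| := le_abs_self _
          have h6 : -est y ≤ |est y| := neg_le_abs _
          have h7 := sq_abs (est y)
          have h8 := mul_le_mul_of_nonneg_right h5 hz
          have h9 := mul_le_mul_of_nonneg_right h6 hz
          refine le_min ?_ ?_ <;> linarith
        have h8 : 0 < (δ * t) ^ 2 := by positivity
        linarith
      exact abs_lt_of_sq_lt_sq h3 hδt.le
    have d1 := abs_lt.mp (hab a ha0 c1)
    have d2 := abs_lt.mp (hab a' ha0' c2)
    linarith [d1.1, d1.2, d2.1, d2.2]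
  · intro est
    refine two_point hζ hm hm' n hmin (fun π y => 2 * (g ^ 6 / 100000) / (n * δ ^ 2 * ε ^ 4 * ζ ^ 6)
                ≤ |(1 - (est y) ^ 2) / (1 - π.1.1 ^ 2) - 1| ^ 2) ?_
    intro y
    simp only [pack_mk sv hε']
    have hthr : 2 * (g ^ 6 / 100000) / (n * δ ^ 2 * ε ^ 4 * ζ ^ 6) = (t / 2) ^ 2 := by
      rw [div_pow, ht2, hX, hζb]
      field_simp
      try norm_num
    rw [hthr]
    by_contra hcon
    push Not at hcon
    obtain ⟨c1, c2⟩ := hcon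
    have d1 := abs_lt.mp (lt_of_pow_lt_pow_left₀ 2 (by positivity) c1)
    have d2 := abs_lt.mp (lt_of_pow_lt_pow_left₀ 2 (by positivity) c2)
    have v1 : 1 - a ^ 2 = 5 * δ * (1 + t) ^ 2 := by rw [haV]; ring
    have v2 : 1 - a' ^ 2 = 5 * δ := by rw [haV']; ring
    rw [v1] at d1
    rw [v2] at d2
    have f1 : 1 - t / 2 < (1 - est y ^ 2) / (5 * δ * (1 + t) ^ 2) := by linarith [d1.1]
    have f2 : (1 - est y ^ 2) / (5 * δ) < 1 + t / 2 := by linarith [d2.2]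
    rw [lt_div_iff₀ (by positivity)] at f1
    rw [div_lt_iff₀ (by positivity)] at f2
    have f3 : 1 + t / 2 ≤ (1 - t / 2) * (1 + t) ^ 2 := by
      have h1 : t * t ^ 2 ≤ t * 1 := by
        refine mul_le_mul_of_nonneg_left ?_ ht0.le
        exact pow_le_one₀ ht0.le (by linarith)
      linarith
    have f4 : (1 + t / 2) * (5 * δ) ≤ (1 - t / 2) * (1 + t) ^ 2 * (5 * δ) := by gcongr
    linarith

end PaperHMM
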